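/- (Cut admissibility for HyLL, unbounded cut) If the sequents Γ; · ⊢ A @ u and Γ, A @ u; Δ ⊢ C @ w are derivable in HyLL, then the sequent Γ; Δ ⊢ C @ w is derivable in HyLL. -/

import Mathlib

/-!
HyLL (Hybrid Linear Logic) over a constraint domain: a monoid `⟨W, *, 1⟩` of worlds.
Formulas use higher-order abstract syntax for the binders (term quantifiers,
world quantifiers and the localization `↓u.A`), so substitution `A[w/u]` is
function application.
-/

namespace HyLL

/-- HyLL formulas over worlds `W`, atomic predicate names `A` and first-order terms `T`.
Atoms are `p(t⃗)`.  Connectives: `⊗, 1, ⊸, &, ⊤, ⊕, 0, !`, quantifiers over terms and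
worlds, and the hybrid connectives `(A at u)` and `↓u.A`. -/
inductive HF (W A T : Type) : Type where
  | atom : A → List T → HF W A T
  | tens : HF W A T → HF W A T → HF W A T
  | one : HF W A T
  | limp : HF W A T → HF W A T → HF W A T
  | with_ : HF W A T → HF W A T → HF W A T
  | top : HF W A T
  | plus : HF W A T → HF W A T → HF W A T
  | zero : HF W A T
  | bang : HF W A T → HF W A T
  | allT : (T → HF W A T) → HF W A T
  | exT : (T → HF W A T) → HF W A T
  | allW : (W → HF W A T) → HF W A T
  | exW : (W → HF W A T) → HF W A T
  | att : HF W A T → W → HF W A T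
  | down : (W → HF W A T) → HF W A T

/-- A HyLL judgment `A @ w`. -/
abbrev Jdg (W A T : Type) := HF W A T × W

variable {W A T : Type} [Monoid W]

/-- The HyLL sequent calculus: `HSeq Γ Δ C w` means `Γ; Δ ⊢ C @ w` is derivable,
where `Γ` is the unbounded context (a set) and `Δ` the linear context (a multiset). -/
inductive HSeq : Set (Jdg W A T) → Multiset (Jdg W A T) → HF W A T → W → Prop where
  | init (Γ) (a : A) (ts : List T) (w : W) :
      HSeq Γ {(.atom a ts, w)} (.atom a ts) w
  | copy {Γ Δ B u C w} : (B, u) ∈ Γ →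
      HSeq Γ ((B, u) ::ₘ Δ) C w → HSeq Γ Δ C w
  | tensR {Γ Δ Δ' B C w} : HSeq Γ Δ B w → HSeq Γ Δ' C w →
      HSeq Γ (Δ + Δ') (.tens B C) w
  | tensL {Γ Δ B C u D w} : HSeq Γ ((B, u) ::ₘ (C, u) ::ₘ Δ) D w →
      HSeq Γ ((.tens B C, u) ::ₘ Δ) D w
  | oneR (Γ) (w : W) : HSeq Γ 0 .one w
  | oneL {Γ Δ u C w} : HSeq Γ Δ C w → HSeq Γ ((.one, u) ::ₘ Δ) C w
  | limpR {Γ Δ B C w} : HSeq Γ ((B, w) ::ₘ Δ) C w → HSeq Γ Δ (.limp B C) w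
  | limpL {Γ Δ Δ' B C u D w} : HSeq Γ Δ B u → HSeq Γ ((C, u) ::ₘ Δ') D w →
      HSeq Γ ((.limp B C, u) ::ₘ (Δ + Δ')) D w
  | withR {Γ Δ B C w} : HSeq Γ Δ B w → HSeq Γ Δ C w → HSeq Γ Δ (.with_ B C) w
  | withL1 {Γ Δ B C u D w} : HSeq Γ ((B, u) ::ₘ Δ) D w →
      HSeq Γ ((.with_ B C, u) ::ₘ Δ) D w
  | withL2 {Γ Δ B C u D w} : HSeq Γ ((C, u) ::ₘ Δ) D w →
      HSeq Γ ((.with_ B C, u) ::ₘ Δ) D w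
  | topR (Γ Δ) (w : W) : HSeq Γ Δ .top w
  | plusR1 {Γ Δ B C w} : HSeq Γ Δ B w → HSeq Γ Δ (.plus B C) w
  | plusR2 {Γ Δ B C w} : HSeq Γ Δ C w → HSeq Γ Δ (.plus B C) w
  | plusL {Γ Δ B C u D w} : HSeq Γ ((B, u) ::ₘ Δ) D w → HSeq Γ ((C, u) ::ₘ Δ) D w →
      HSeq Γ ((.plus B C, u) ::ₘ Δ) D w
  | zeroL (Γ Δ) (u : W) (C : HF W A T) (w : W) : HSeq Γ ((.zero, u) ::ₘ Δ) C w
  | bangR {Γ B w} : HSeq Γ 0 B w → HSeq Γ 0 (.bang B) w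
  | bangL {Γ Δ B u C w} : HSeq (insert (B, u) Γ) Δ C w →
      HSeq Γ ((.bang B, u) ::ₘ Δ) C w
  | allTR {Γ Δ B w} : (∀ t : T, HSeq Γ Δ (B t) w) → HSeq Γ Δ (.allT B) w
  | allTL {Γ Δ B u C w} (t : T) : HSeq Γ ((B t, u) ::ₘ Δ) C w →
      HSeq Γ ((.allT B, u) ::ₘ Δ) C w
  | exTR {Γ Δ B w} (t : T) : HSeq Γ Δ (B t) w → HSeq Γ Δ (.exT B) w
  | exTL {Γ Δ B u C w} : (∀ t : T, HSeq Γ ((B t, u) ::ₘ Δ) C w) →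
      HSeq Γ ((.exT B, u) ::ₘ Δ) C w
  | allWR {Γ Δ B w} : (∀ v : W, HSeq Γ Δ (B v) w) → HSeq Γ Δ (.allW B) w
  | allWL {Γ Δ B u C w} (v : W) : HSeq Γ ((B v, u) ::ₘ Δ) C w →
      HSeq Γ ((.allW B, u) ::ₘ Δ) C w
  | exWR {Γ Δ B w} (v : W) : HSeq Γ Δ (B v) w → HSeq Γ Δ (.exW B) w
  | exWL {Γ Δ B u C w} : (∀ v : W, HSeq Γ ((B v, u) ::ₘ Δ) C w) →
      HSeq Γ ((.exW B, u) ::ₘ Δ) C w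
  | attR {Γ Δ B u w} : HSeq Γ Δ B u → HSeq Γ Δ (.att B u) w
  | attL {Γ Δ B u v C w} : HSeq Γ ((B, u) ::ₘ Δ) C w →
      HSeq Γ ((.att B u, v) ::ₘ Δ) C w
  | downR {Γ Δ B w} : HSeq Γ Δ (B w) w → HSeq Γ Δ (.down B) w
  | downL {Γ Δ B v C w} : HSeq Γ ((B v, v) ::ₘ Δ) C w →
      HSeq Γ ((.down B, v) ::ₘ Δ) C w

end HyLL

namespace HyLL

section CutAdmissibility

variable {W A T : Type}

theorem HSeq.of_eq {Γ : Set (Jdg W A T)} {Δ Δ' : Multiset (Jdg W A T)} {C : HF W A T} {w : W}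
    (h : HSeq Γ Δ C w) (e : Δ = Δ') : HSeq Γ Δ' C w := e ▸ h

/-- Weakening of the unbounded context. -/
theorem HSeq.weaken {Γ Γ' : Set (Jdg W A T)} {Δ : Multiset (Jdg W A T)} {C : HF W A T} {w : W}
    (h : HSeq Γ Δ C w) (hΓ : Γ ⊆ Γ') : HSeq Γ' Δ C w := by
  induction h generalizing Γ' with
  | init => exact .init ..
  | copy hm _ ih => exact .copy (hΓ hm) (ih hΓ)
  | tensR _ _ ih₁ ih₂ => exact .tensR (ih₁ hΓ) (ih₂ hΓ)
  | tensL _ ih => exact .tensL (ih hΓ)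
  | oneR => exact .oneR ..
  | oneL _ ih => exact .oneL (ih hΓ)
  | limpR _ ih => exact .limpR (ih hΓ)
  | limpL _ _ ih₁ ih₂ => exact .limpL (ih₁ hΓ) (ih₂ hΓ)
  | withR _ _ ih₁ ih₂ => exact .withR (ih₁ hΓ) (ih₂ hΓ)
  | withL1 _ ih => exact .withL1 (ih hΓ)
  | withL2 _ ih => exact .withL2 (ih hΓ)
  | topR => exact .topR ..
  | plusR1 _ ih => exact .plusR1 (ih hΓ)
  | plusR2 _ ih => exact .plusR2 (ih hΓ)
  | plusL _ _ ih₁ ih₂ => exact .plusL (ih₁ hΓ) (ih₂ hΓ)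
  | zeroL => exact .zeroL ..
  | bangR _ ih => exact .bangR (ih hΓ)
  | bangL _ ih => exact .bangL (ih (Set.insert_subset_insert hΓ))
  | allTR _ ih => exact .allTR fun t => ih t hΓ
  | allTL t _ ih => exact .allTL t (ih hΓ)
  | exTR t _ ih => exact .exTR t (ih hΓ)
  | exTL _ ih => exact .exTL fun t => ih t hΓ
  | allWR _ ih => exact .allWR fun v => ih v hΓ
  | allWL v _ ih => exact .allWL v (ih hΓ)
  | exWR v _ ih => exact .exWR v (ih hΓ)
  | exWL _ ih => exact .exWL fun v => ih v hΓ
  | attR _ ih => exact .attR (ih hΓ)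
  | attL _ ih => exact .attL (ih hΓ)
  | downR _ ih => exact .downR (ih hΓ)
  | downL _ ih => exact .downL (ih hΓ)

/-- Admissibility of the linear cut on the formula `B`. -/
def CutAt (B : HF W A T) : Prop :=
  ∀ ⦃u : W⦄ ⦃Γ : Set (Jdg W A T)⦄ ⦃Δ Δ' : Multiset (Jdg W A T)⦄ ⦃C : HF W A T⦄ ⦃w : W⦄,
    HSeq Γ Δ B u → HSeq Γ ((B, u) ::ₘ Δ') C w → HSeq Γ (Δ + Δ') C w

/-- The linear cut is admissible on every immediate subformula. -/
def SubformulaCut : HF W A T → Prop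
  | .atom _ _ => True
  | .tens B C => CutAt B ∧ CutAt C
  | .one => True
  | .limp B C => CutAt B ∧ CutAt C
  | .with_ B C => CutAt B ∧ CutAt C
  | .top => True
  | .plus B C => CutAt B ∧ CutAt C
  | .zero => True
  | .bang B => CutAt B
  | .allT B => ∀ t, CutAt (B t)
  | .exT B => ∀ t, CutAt (B t)
  | .allW B => ∀ v, CutAt (B v)
  | .exW B => ∀ v, CutAt (B v)
  | .att B _ => CutAt B
  | .down B => ∀ v, CutAt (B v)

/-- The premises of some right rule (or `init`) concluding `Γ; Δ ⊢ B @ w` are derivable. -/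
def RightPremises (Γ : Set (Jdg W A T)) (Δ : Multiset (Jdg W A T)) (w : W) : HF W A T → Prop
  | .atom a ts => Δ = {(.atom a ts, w)}
  | .tens B C => ∃ Δ₁ Δ₂, Δ = Δ₁ + Δ₂ ∧ HSeq Γ Δ₁ B w ∧ HSeq Γ Δ₂ C w
  | .one => Δ = 0
  | .limp B C => HSeq Γ ((B, w) ::ₘ Δ) C w
  | .with_ B C => HSeq Γ Δ B w ∧ HSeq Γ Δ C w
  | .top => True
  | .plus B C => HSeq Γ Δ B w ∨ HSeq Γ Δ C w
  | .zero => False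
  | .bang B => Δ = 0 ∧ HSeq Γ 0 B w
  | .allT B => ∀ t, HSeq Γ Δ (B t) w
  | .exT B => ∃ t, HSeq Γ Δ (B t) w
  | .allW B => ∀ v, HSeq Γ Δ (B v) w
  | .exW B => ∃ v, HSeq Γ Δ (B v) w
  | .att B v => HSeq Γ Δ B v
  | .down B => HSeq Γ Δ (B w) w

theorem RightPremises.weaken {Γ Γ' : Set (Jdg W A T)} {Δ : Multiset (Jdg W A T)} {B : HF W A T}
    {w : W} (h : RightPremises Γ Δ w B) (hΓ : Γ ⊆ Γ') : RightPremises Γ' Δ w B := by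
  cases B with
  | atom | one | top | zero => exact h
  | tens B C =>
    obtain ⟨Δ₁, Δ₂, e, h₁, h₂⟩ := h
    exact ⟨Δ₁, Δ₂, e, h₁.weaken hΓ, h₂.weaken hΓ⟩
  | limp | att | down => exact HSeq.weaken h hΓ
  | with_ B C => exact ⟨h.1.weaken hΓ, h.2.weaken hΓ⟩
  | plus B C => exact h.imp (·.weaken hΓ) (·.weaken hΓ)
  | bang B => exact ⟨h.1, h.2.weaken hΓ⟩
  | allT B | allW B => exact fun t => (h t).weaken hΓ
  | exT B | exW B => exact h.imp fun _ h => h.weaken hΓ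

theorem add_eq_cons {α : Type*} {s t r : Multiset α} {a : α} (h : s + t = a ::ₘ r) :
    (∃ s', s = a ::ₘ s' ∧ r = s' + t) ∨ ∃ t', t = a ::ₘ t' ∧ r = s + t' := by
  have ha : a ∈ s + t := h ▸ Multiset.mem_cons_self a r
  rcases Multiset.mem_add.mp ha with ha | ha
  · obtain ⟨s', rfl⟩ := Multiset.exists_cons_of_mem ha
    rw [Multiset.cons_add, Multiset.cons_inj_right] at h
    exact .inl ⟨s', rfl, h.symm⟩
  · obtain ⟨t', rfl⟩ := Multiset.exists_cons_of_mem ha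
    rw [Multiset.add_cons, Multiset.cons_inj_right] at h
    exact .inr ⟨t', rfl, h.symm⟩

theorem cons_eq_cons_cases {α : Type*} {a b : α} {s t : Multiset α} (h : a ::ₘ s = b ::ₘ t) :
    (a = b ∧ s = t) ∨ ∃ r, s = b ::ₘ r ∧ t = a ::ₘ r := by
  rcases Multiset.cons_eq_cons.mp h with h | ⟨-, h⟩
  · exact .inl h
  · exact .inr h

/-- The linear cut on `B` implies the unbounded cut on `B`. -/
theorem CutAt.unbounded {B : HF W A T} (hB : CutAt B) {Γ : Set (Jdg W A T)}
    {Δ : Multiset (Jdg W A T)} {C : HF W A T} {u w : W} (h₁ : HSeq Γ 0 B u)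
    (h₂ : HSeq (insert (B, u) Γ) Δ C w) : HSeq Γ Δ C w := by
  generalize hΓ' : insert (B, u) Γ = Γ' at h₂
  induction h₂ generalizing Γ with
  | init => exact .init ..
  | copy hm _ ih =>
    subst hΓ'
    rcases hm with hm | hm
    · obtain ⟨rfl, rfl⟩ := Prod.mk.inj hm
      exact (hB h₁ (ih h₁ rfl)).of_eq (zero_add _)
    · exact .copy hm (ih h₁ rfl)
  | tensR _ _ ih₁ ih₂ => exact .tensR (ih₁ h₁ hΓ') (ih₂ h₁ hΓ')
  | tensL _ ih => exact .tensL (ih h₁ hΓ')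
  | oneR => exact .oneR ..
  | oneL _ ih => exact .oneL (ih h₁ hΓ')
  | limpR _ ih => exact .limpR (ih h₁ hΓ')
  | limpL _ _ ih₁ ih₂ => exact .limpL (ih₁ h₁ hΓ') (ih₂ h₁ hΓ')
  | withR _ _ ih₁ ih₂ => exact .withR (ih₁ h₁ hΓ') (ih₂ h₁ hΓ')
  | withL1 _ ih => exact .withL1 (ih h₁ hΓ')
  | withL2 _ ih => exact .withL2 (ih h₁ hΓ')
  | topR => exact .topR ..
  | plusR1 _ ih => exact .plusR1 (ih h₁ hΓ')
  | plusR2 _ ih => exact .plusR2 (ih h₁ hΓ')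
  | plusL _ _ ih₁ ih₂ => exact .plusL (ih₁ h₁ hΓ') (ih₂ h₁ hΓ')
  | zeroL => exact .zeroL ..
  | bangR _ ih => exact .bangR (ih h₁ hΓ')
  | bangL _ ih =>
    subst hΓ'
    exact .bangL (ih (h₁.weaken (Set.subset_insert _ _)) (Set.insert_comm _ _ _))
  | allTR _ ih => exact .allTR fun t => ih t h₁ hΓ'
  | allTL t _ ih => exact .allTL t (ih h₁ hΓ')
  | exTR t _ ih => exact .exTR t (ih h₁ hΓ')
  | exTL _ ih => exact .exTL fun t => ih t h₁ hΓ'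
  | allWR _ ih => exact .allWR fun v => ih v h₁ hΓ'
  | allWL v _ ih => exact .allWL v (ih h₁ hΓ')
  | exWR v _ ih => exact .exWR v (ih h₁ hΓ')
  | exWL _ ih => exact .exWL fun v => ih v h₁ hΓ'
  | attR _ ih => exact .attR (ih h₁ hΓ')
  | attL _ ih => exact .attL (ih h₁ hΓ')
  | downR _ ih => exact .downR (ih h₁ hΓ')
  | downL _ ih => exact .downL (ih h₁ hΓ')

/-- Cut against a formula introduced by the last rule of the left derivation. -/
theorem RightPremises.cut {B : HF W A T} (hB : SubformulaCut B) {Γ : Set (Jdg W A T)}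
    {Δ Δ' : Multiset (Jdg W A T)} {C : HF W A T} {u w : W} (h₁ : RightPremises Γ Δ u B)
    (h₂ : HSeq Γ ((B, u) ::ₘ Δ') C w) : HSeq Γ (Δ + Δ') C w := by
  generalize e : (B, u) ::ₘ Δ' = Δ₀ at h₂
  have swap {x : Jdg W A T} {Δ' Δ₀} (e : (B, u) ::ₘ Δ' = Δ₀) :
      (B, u) ::ₘ x ::ₘ Δ' = x ::ₘ Δ₀ := by rw [← e, Multiset.cons_swap]
  have pull {Γ : Set (Jdg W A T)} {x : Jdg W A T} {Δ' C w} (h : HSeq Γ (Δ + x ::ₘ Δ') C w) :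
      HSeq Γ (x ::ₘ (Δ + Δ')) C w := h.of_eq (Multiset.add_cons ..)
  have push {Γ : Set (Jdg W A T)} {x : Jdg W A T} {Δ' C w} (h : HSeq Γ (x ::ₘ (Δ + Δ')) C w) :
      HSeq Γ (Δ + x ::ₘ Δ') C w := h.of_eq (Multiset.add_cons ..).symm
  induction h₂ generalizing Δ' with
  | init Γ a ts w =>
    obtain ⟨e', rfl⟩ | ⟨r, -, hr⟩ := cons_eq_cons_cases e
    swap
    · exact absurd hr.symm (Multiset.cons_ne_zero)
    obtain ⟨rfl, rfl⟩ := Prod.mk.inj e'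
    exact (HSeq.init ..).of_eq (by rw [show Δ = _ from h₁, add_zero])
  | copy hm _ ih => exact .copy hm (pull (ih h₁ (swap e)))
  | tensR hl hr ih₁ ih₂ =>
    rcases add_eq_cons e.symm with ⟨s, rfl, rfl⟩ | ⟨s, rfl, rfl⟩
    · exact (HSeq.tensR (ih₁ h₁ rfl) hr).of_eq (add_assoc ..)
    · exact (HSeq.tensR hl (ih₂ h₁ rfl)).of_eq (add_left_comm ..)
  | tensL h ih =>
    rcases cons_eq_cons_cases e with ⟨e', rfl⟩ | ⟨r, rfl, rfl⟩
    · obtain ⟨rfl, rfl⟩ := Prod.mk.inj e'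
      obtain ⟨Δ₁, Δ₂, rfl, hl, hr⟩ := h₁
      exact (hB.2 hr ((hB.1 hl h).of_eq (Multiset.add_cons ..))).of_eq (by abel)
    · exact push (.tensL ((ih h₁ (by rw [swap (swap rfl)])).of_eq (by simp only [Multiset.add_cons])))
  | oneR => exact absurd e (Multiset.cons_ne_zero)
  | oneL h ih =>
    rcases cons_eq_cons_cases e with ⟨e', rfl⟩ | ⟨r, rfl, rfl⟩
    · obtain ⟨rfl, rfl⟩ := Prod.mk.inj e'
      exact h.of_eq (by rw [show Δ = 0 from h₁, zero_add])
    · exact push (.oneL (ih h₁ rfl))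
  | limpR _ ih => exact .limpR (pull (ih h₁ (swap e)))
  | limpL hl hr ih₁ ih₂ =>
    rcases cons_eq_cons_cases e with ⟨e', rfl⟩ | ⟨r, rfl, hr'⟩
    · obtain ⟨rfl, rfl⟩ := Prod.mk.inj e'
      exact (hB.2 (hB.1 hl h₁) hr).of_eq (by abel)
    · rcases add_eq_cons hr' with ⟨s, rfl, rfl⟩ | ⟨s, rfl, rfl⟩
      · exact push ((HSeq.limpL (ih₁ h₁ rfl) hr).of_eq (by rw [add_assoc]))
      · exact push ((HSeq.limpL hl (pull (ih₂ h₁ (swap rfl)))).of_eq (by rw [add_left_comm]))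
  | withR _ _ ih₁ ih₂ => exact .withR (ih₁ h₁ e) (ih₂ h₁ e)
  | withL1 h ih =>
    rcases cons_eq_cons_cases e with ⟨e', rfl⟩ | ⟨r, rfl, rfl⟩
    · obtain ⟨rfl, rfl⟩ := Prod.mk.inj e'
      exact hB.1 h₁.1 h
    · exact push (.withL1 (pull (ih h₁ (swap rfl))))
  | withL2 h ih =>
    rcases cons_eq_cons_cases e with ⟨e', rfl⟩ | ⟨r, rfl, rfl⟩
    · obtain ⟨rfl, rfl⟩ := Prod.mk.inj e'
      exact hB.2 h₁.2 h
    · exact push (.withL2 (pull (ih h₁ (swap rfl))))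
  | topR => exact .topR ..
  | plusR1 _ ih => exact .plusR1 (ih h₁ e)
  | plusR2 _ ih => exact .plusR2 (ih h₁ e)
  | plusL hl hr ih₁ ih₂ =>
    rcases cons_eq_cons_cases e with ⟨e', rfl⟩ | ⟨r, rfl, rfl⟩
    · obtain ⟨rfl, rfl⟩ := Prod.mk.inj e'
      exact h₁.elim (hB.1 · hl) (hB.2 · hr)
    · exact push (.plusL (pull (ih₁ h₁ (swap rfl))) (pull (ih₂ h₁ (swap rfl))))
  | zeroL =>
    rcases cons_eq_cons_cases e with ⟨e', rfl⟩ | ⟨r, rfl, rfl⟩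
    · obtain ⟨rfl, rfl⟩ := Prod.mk.inj e'
      exact h₁.elim
    · exact push (.zeroL ..)
  | bangR => exact absurd e (Multiset.cons_ne_zero)
  | bangL h ih =>
    rcases cons_eq_cons_cases e with ⟨e', rfl⟩ | ⟨r, rfl, rfl⟩
    · obtain ⟨rfl, rfl⟩ := Prod.mk.inj e'
      obtain ⟨rfl, h₁⟩ := h₁
      exact (hB.unbounded h₁ h).of_eq (zero_add _).symm
    · exact push (.bangL (ih (h₁.weaken (Set.subset_insert _ _)) rfl))
  | allTR _ ih => exact .allTR fun t => ih t h₁ e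
  | allTL t h ih =>
    rcases cons_eq_cons_cases e with ⟨e', rfl⟩ | ⟨r, rfl, rfl⟩
    · obtain ⟨rfl, rfl⟩ := Prod.mk.inj e'
      exact hB t (h₁ t) h
    · exact push (.allTL t (pull (ih h₁ (swap rfl))))
  | exTR t _ ih => exact .exTR t (ih h₁ e)
  | exTL h ih =>
    rcases cons_eq_cons_cases e with ⟨e', rfl⟩ | ⟨r, rfl, rfl⟩
    · obtain ⟨rfl, rfl⟩ := Prod.mk.inj e'
      obtain ⟨t, h₁⟩ := h₁
      exact hB t h₁ (h t)
    · exact push (.exTL fun t => pull (ih t h₁ (swap rfl)))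
  | allWR _ ih => exact .allWR fun v => ih v h₁ e
  | allWL v h ih =>
    rcases cons_eq_cons_cases e with ⟨e', rfl⟩ | ⟨r, rfl, rfl⟩
    · obtain ⟨rfl, rfl⟩ := Prod.mk.inj e'
      exact hB v (h₁ v) h
    · exact push (.allWL v (pull (ih h₁ (swap rfl))))
  | exWR v _ ih => exact .exWR v (ih h₁ e)
  | exWL h ih =>
    rcases cons_eq_cons_cases e with ⟨e', rfl⟩ | ⟨r, rfl, rfl⟩
    · obtain ⟨rfl, rfl⟩ := Prod.mk.inj e'
      obtain ⟨v, h₁⟩ := h₁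
      exact hB v h₁ (h v)
    · exact push (.exWL fun v => pull (ih v h₁ (swap rfl)))
  | attR _ ih => exact .attR (ih h₁ e)
  | attL h ih =>
    rcases cons_eq_cons_cases e with ⟨e', rfl⟩ | ⟨r, rfl, rfl⟩
    · obtain ⟨rfl, rfl⟩ := Prod.mk.inj e'
      exact hB h₁ h
    · exact push (.attL (pull (ih h₁ (swap rfl))))
  | downR _ ih => exact .downR (ih h₁ e)
  | downL h ih =>
    rcases cons_eq_cons_cases e with ⟨e', rfl⟩ | ⟨r, rfl, rfl⟩
    · obtain ⟨rfl, rfl⟩ := Prod.mk.inj e'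
      exact hB _ h₁ h
    · exact push (.downL (pull (ih h₁ (swap rfl))))

theorem SubformulaCut.cutAt {B : HF W A T} (hB : SubformulaCut B) : CutAt B := by
  intro u Γ Δ Δ' C w h₁ h₂
  induction h₁ generalizing Δ' C w with
  | init => exact RightPremises.cut hB rfl h₂
  | copy hm _ ih => exact .copy hm ((ih hB h₂).of_eq (Multiset.cons_add ..))
  | tensR hl hr => exact RightPremises.cut hB ⟨_, _, rfl, hl, hr⟩ h₂
  | tensL _ ih =>
    exact (HSeq.tensL ((ih hB h₂).of_eq (by simp only [Multiset.cons_add]))).of_eq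
      (Multiset.cons_add ..).symm
  | oneR => exact RightPremises.cut hB rfl h₂
  | oneL _ ih => exact (HSeq.oneL (ih hB h₂)).of_eq (Multiset.cons_add ..).symm
  | limpR h => exact RightPremises.cut hB h h₂
  | limpL hl _ _ ih =>
    exact (HSeq.limpL hl ((ih hB h₂).of_eq (Multiset.cons_add ..))).of_eq
      (by rw [Multiset.cons_add, add_assoc])
  | withR hl hr => exact RightPremises.cut hB ⟨hl, hr⟩ h₂
  | topR => exact RightPremises.cut hB trivial h₂
  | plusR1 h => exact RightPremises.cut hB (.inl h) h₂
  | plusR2 h => exact RightPremises.cut hB (.inr h) h₂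
  | plusL _ _ ih₁ ih₂ =>
    exact (HSeq.plusL ((ih₁ hB h₂).of_eq (Multiset.cons_add ..))
      ((ih₂ hB h₂).of_eq (Multiset.cons_add ..))).of_eq (Multiset.cons_add ..).symm
  | zeroL => exact (HSeq.zeroL ..).of_eq (Multiset.cons_add ..).symm
  | bangR h => exact RightPremises.cut hB ⟨rfl, h⟩ h₂
  | bangL _ ih =>
    exact (HSeq.bangL (ih hB (h₂.weaken (Set.subset_insert _ _)))).of_eq
      (Multiset.cons_add ..).symm
  | allTR h => exact RightPremises.cut hB h h₂
  | exTR t h => exact RightPremises.cut hB ⟨t, h⟩ h₂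
  | allWR h => exact RightPremises.cut hB h h₂
  | exWR v h => exact RightPremises.cut hB ⟨v, h⟩ h₂
  | attR h => exact RightPremises.cut hB h h₂
  | downR h => exact RightPremises.cut hB h h₂
  | withL1 _ ih =>
    exact (HSeq.withL1 ((ih hB h₂).of_eq (Multiset.cons_add ..))).of_eq (Multiset.cons_add ..).symm
  | withL2 _ ih =>
    exact (HSeq.withL2 ((ih hB h₂).of_eq (Multiset.cons_add ..))).of_eq (Multiset.cons_add ..).symm
  | allTL t _ ih =>
    exact (HSeq.allTL t ((ih hB h₂).of_eq (Multiset.cons_add ..))).of_eq (Multiset.cons_add ..).symm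
  | allWL v _ ih =>
    exact (HSeq.allWL v ((ih hB h₂).of_eq (Multiset.cons_add ..))).of_eq (Multiset.cons_add ..).symm
  | attL _ ih =>
    exact (HSeq.attL ((ih hB h₂).of_eq (Multiset.cons_add ..))).of_eq (Multiset.cons_add ..).symm
  | downL _ ih =>
    exact (HSeq.downL ((ih hB h₂).of_eq (Multiset.cons_add ..))).of_eq (Multiset.cons_add ..).symm
  | exTL _ ih =>
    exact (HSeq.exTL fun t => (ih t hB h₂).of_eq (Multiset.cons_add ..)).of_eq
      (Multiset.cons_add ..).symm
  | exWL _ ih =>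
    exact (HSeq.exWL fun v => (ih v hB h₂).of_eq (Multiset.cons_add ..)).of_eq
      (Multiset.cons_add ..).symm

/-- Admissibility of the linear cut. -/
theorem cutAt (B : HF W A T) : CutAt B := by
  induction B with
  | atom | one | top | zero => exact SubformulaCut.cutAt trivial
  | tens _ _ ih₁ ih₂ | limp _ _ ih₁ ih₂ | with_ _ _ ih₁ ih₂ | plus _ _ ih₁ ih₂ =>
    exact SubformulaCut.cutAt ⟨ih₁, ih₂⟩
  | bang _ ih | att _ _ ih | allT _ ih | exT _ ih | allW _ ih | exW _ ih | down _ ih =>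
    exact SubformulaCut.cutAt ih

end CutAdmissibility

end HyLL

/-- **Cut admissibility for HyLL (unbounded cut).**  If `Γ; · ⊢ A @ u` and
`Γ, A @ u; Δ ⊢ C @ w` are derivable in HyLL, then so is `Γ; Δ ⊢ C @ w`. -/
theorem hyll_cut_unbounded {W A T : Type} [Monoid W]
    (Γ : Set (HyLL.Jdg W A T)) (Δ : Multiset (HyLL.Jdg W A T))
    (B C : HyLL.HF W A T) (u w : W)
    (h₁ : HyLL.HSeq Γ 0 B u)
    (h₂ : HyLL.HSeq (insert (B, u) Γ) Δ C w) :
    HyLL.HSeq Γ Δ C w := by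
  exact (HyLL.cutAt B).unbounded h₁ h₂
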